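/- Let n ≥ 1 and k ≥ 1. The path graph P_n is Z_{2^k}-AW if and only if n ≡ 0 or 1 (mod 3). -/

import Mathlib

-- Toggling a vertex `v` in the `ZMod m`-labeling lights out game:
-- the label of `v` is added to the labels of `v` and all its neighbors.
open Classical in
noncomputable def gToggle {V : Type*} (G : SimpleGraph V) {m : ℕ} (v : V)
    (lab : V → ZMod m) : V → ZMod m :=
  fun w => if w = v ∨ G.Adj v w then lab v + lab w else lab w

/-- The result of toggling, in order, the vertices in the list `L`
in the `ZMod m`-labeling lights out game. -/
noncomputable def gPlay {V : Type*} (G : SimpleGraph V) {m : ℕ} (L : List V)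
    (lab : V → ZMod m) : V → ZMod m :=
  L.foldl (fun l v => gToggle G v l) lab

/-- A labeling is winnable in the `ZMod m`-labeling lights out game if some
finite sequence of toggles transforms it into the zero labeling. -/
def gWinnable {V : Type*} (G : SimpleGraph V) {m : ℕ} (lab : V → ZMod m) : Prop :=
  ∃ L : List V, gPlay G L lab = 0

/-- `G` is `ZMod m`-Always Winnable: every labeling is winnable
in the `ZMod m`-labeling lights out game. -/
def gAW {V : Type*} (G : SimpleGraph V) (m : ℕ) : Prop :=
  ∀ lab : V → ZMod m, gWinnable G lab

-- Toggling a vertex `v` in the neighborhood `m`-lights out game: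
-- the labels of `v` and all its neighbors are increased by `1`.
open Classical in
noncomputable def nToggle {V : Type*} (G : SimpleGraph V) {m : ℕ} (v : V)
    (lab : V → ZMod m) : V → ZMod m :=
  fun w => if w = v ∨ G.Adj v w then lab w + 1 else lab w

/-- The result of toggling, in order, the vertices in the list `L`
in the neighborhood `m`-lights out game. -/
noncomputable def nPlay {V : Type*} (G : SimpleGraph V) {m : ℕ} (L : List V)
    (lab : V → ZMod m) : V → ZMod m :=
  L.foldl (fun l v => nToggle G v l) lab

/-- A labeling is `(N,m)`-winnable if some finite sequence of toggles in the
neighborhood `m`-lights out game transforms it into the zero labeling. -/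
def nWinnable {V : Type*} (G : SimpleGraph V) {m : ℕ} (lab : V → ZMod m) : Prop :=
  ∃ L : List V, nPlay G L lab = 0

/-- `G` is `(N,m)`-Always Winnable: every labeling is winnable
in the neighborhood `m`-lights out game. -/
def nAW {V : Type*} (G : SimpleGraph V) (m : ℕ) : Prop :=
  ∀ lab : V → ZMod m, nWinnable G lab

/-- The parity of an element of `ZMod n`, as an element of `ZMod 2`:
`1` if its representatives are odd, `0` if they are even. -/
def parity {n : ℕ} (x : ZMod n) : ZMod 2 :=
  if x.val % 2 = 1 then 1 else 0

theorem gPlay_append {V : Type*} (G : SimpleGraph V) {m : ℕ} (L M : List V)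
    (lab : V → ZMod m) : gPlay G (L ++ M) lab = gPlay G M (gPlay G L lab) :=
  List.foldl_append

/-- Play commutes with additive maps on labels. -/
theorem gPlay_map {V : Type*} (G : SimpleGraph V) {a b : ℕ} (φ : ZMod a →+ ZMod b)
    (L : List V) (lab : V → ZMod a) : gPlay G L (φ ∘ lab) = φ ∘ gPlay G L lab := by
  induction L generalizing lab with
  | nil => rfl
  | cons v L ih =>
    have h : gToggle G v (φ ∘ lab) = φ ∘ gToggle G v lab := by
      funext w
      simp only [gToggle, Function.comp_apply]
      split_ifs <;> simp
    change gPlay G L (gToggle G v (φ ∘ lab)) = φ ∘ gPlay G L (gToggle G v lab)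
    rw [h, ih]

/-- If `G` is always winnable modulo `d`, integer labelings can be made divisible by any power
of `d`. -/
theorem gAW.exists_gPlay_eq_pow_mul {V : Type*} {G : SimpleGraph V} {d : ℕ} (h : gAW G d) (k : ℕ)
    (lab : V → ZMod 0) :
    ∃ (L : List V) (μ : V → ZMod 0), gPlay G L lab = fun v => (d : ZMod 0) ^ k * μ v := by
  induction k with
  | zero => exact ⟨[], lab, by simp [gPlay]⟩
  | succ k ih =>
    obtain ⟨L, μ, hL⟩ := ih
    obtain ⟨M, hM⟩ := h (ZMod.castHom (dvd_zero d) (ZMod d) ∘ μ)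
    have hM' := gPlay_map G (ZMod.castHom (dvd_zero d) (ZMod d)).toAddMonoidHom M μ
    have hdvd (v : V) : ∃ x : ZMod 0, gPlay G M μ v = (d : ZMod 0) * x := by
      have h0 : (Int.cast (gPlay G M μ v) : ZMod d) = 0 := by
        have := congrFun (hM'.symm.trans hM) v
        exact (map_intCast (ZMod.castHom (dvd_zero d) (ZMod d)) _).symm.trans this
      exact (ZMod.intCast_zmod_eq_zero_iff_dvd _ _).1 h0
    choose ν hν using hdvd
    refine ⟨L ++ M, ν, ?_⟩
    have hmul := gPlay_map G (AddMonoidHom.mulLeft ((d : ZMod 0) ^ k)) M μ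
    rw [gPlay_append, hL]
    refine hmul.trans (funext fun v => ?_)
    simp only [Function.comp_apply, AddMonoidHom.coe_mulLeft, hν]
    ring

theorem gAW.pow {V : Type*} {G : SimpleGraph V} {d : ℕ} (h : gAW G d) (k : ℕ) :
    gAW G (d ^ k) := by
  intro lab
  obtain ⟨lift, hlift⟩ :
      ∃ l : V → ZMod 0, ZMod.castHom (dvd_zero (d ^ k)) (ZMod (d ^ k)) ∘ l = lab := by
    choose l hl using fun v => ZMod.castHom_surjective (dvd_zero (d ^ k)) (lab v)
    exact ⟨l, funext hl⟩
  obtain ⟨L, μ, hL⟩ := h.exists_gPlay_eq_pow_mul k lift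
  refine ⟨L, ?_⟩
  have := gPlay_map G (ZMod.castHom (dvd_zero (d ^ k)) (ZMod (d ^ k))).toAddMonoidHom L lift
  rw [← hlift]
  refine this.trans (funext fun v => ?_)
  have hd : (d : ZMod (d ^ k)) ^ k = 0 := by
    rw [← Nat.cast_pow, ZMod.natCast_self]
  simp only [hL, Function.comp_apply, RingHom.toAddMonoidHom_eq_coe, AddMonoidHom.coe_coe,
    map_mul, map_pow, map_natCast, hd, zero_mul, Pi.zero_apply]

/-- Toggling vertex `i` of a path in the game modulo `2`, with labels extended to all of `ℕ`. -/
def lineToggle (i : ℕ) (f : ℕ → ZMod 2) : ℕ → ZMod 2 :=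
  fun j => if j = i ∨ j = i + 1 ∨ j + 1 = i then f i + f j else f j

/-- `g` is obtained from `f` by toggling vertices below `n`. -/
def LineReach (n : ℕ) (f g : ℕ → ZMod 2) : Prop :=
  Relation.ReflTransGen (fun f g => ∃ i < n, g = lineToggle i f) f g

theorem LineReach.toggle {n i : ℕ} {f g : ℕ → ZMod 2} (hi : i < n)
    (h : LineReach n (lineToggle i f) g) : LineReach n f g :=
  Relation.ReflTransGen.head ⟨i, hi, rfl⟩ h

theorem LineReach.exists_gPlay {n : ℕ} {f g : ℕ → ZMod 2} (h : LineReach n f g) :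
    ∃ L : List (Fin n),
      gPlay (SimpleGraph.pathGraph n) L (fun i => f i) = fun i : Fin n => g i := by
  induction h with
  | refl => exact ⟨[], rfl⟩
  | tail _ hstep ih =>
    obtain ⟨L, hL⟩ := ih
    obtain ⟨i, hi, rfl⟩ := hstep
    refine ⟨L ++ [⟨i, hi⟩], ?_⟩
    rw [gPlay_append, hL]
    funext w
    simp only [gPlay, List.foldl_cons, List.foldl_nil, gToggle, lineToggle,
      SimpleGraph.pathGraph_adj, Fin.ext_iff]
    grind

theorem zmod_two_eq_zero_or_one (x : ZMod 2) : x = 0 ∨ x = 1 := by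
  revert x
  decide

/-- A lit vertex at the end of a fully cleared initial segment of `3 * q` vertices can be put out
without affecting the other vertices. -/
theorem exists_lineReach_fix (n q : ℕ) (hq : 3 * q ≤ n) (f : ℕ → ZMod 2)
    (hf : ∀ i, i + 1 < 3 * q → f i = 0) :
    LineReach n f (fun i => if i < 3 * q then 0 else f i) := by
  induction q generalizing f with
  | zero =>
    simp only [mul_zero, not_lt_zero, if_false]
    exact .refl
  | succ q ih =>
    set s := 3 * q with hs
    have h0 : f s = 0 := hf _ (by omega)
    have h1 : f (s + 1) = 0 := hf _ (by omega)
    rcases zmod_two_eq_zero_or_one (f (s + 2)) with h2 | h2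
    · have := ih (by omega) f (fun i hi => hf i (by omega))
      convert this using 2 with i
      grind
    · refine .toggle (i := s + 2) (by omega) <| .toggle (i := s + 1) (by omega) <|
        .toggle (i := s) (by omega) <| .toggle (i := s + 2) (by omega) ?_
      set g := lineToggle (s + 2) (lineToggle s (lineToggle (s + 1) (lineToggle (s + 2) f)))
        with hg
      have hz : (1 : ZMod 2) + 1 = 0 := by decide
      have hz' (x : ZMod 2) : 1 + (1 + x) = x := by rw [← add_assoc, hz, zero_add]
      have hlow (i : ℕ) (hi : i + 1 < s) : g i = 0 := by
        have := hf i (by omega)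
        simp only [hg, lineToggle]
        grind
      have hhigh (i : ℕ) (hi : s ≤ i) : g i = if i < s + 3 then 0 else f i := by
        obtain rfl | rfl | rfl | rfl | hi :
          i = s ∨ i = s + 1 ∨ i = s + 2 ∨ i = s + 3 ∨ s + 3 < i := by omega
        · simp [hg, lineToggle, Nat.add_assoc, h0, h1, h2, hz]
        · simp [hg, lineToggle, Nat.add_assoc, h0, h1, h2, hz]
        · simp [hg, lineToggle, Nat.add_assoc, h1, h2, hz]
        · simp [hg, lineToggle, Nat.add_assoc, h1, h2, hz, hz']
        · simp only [hg, lineToggle]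
          grind
      have := ih (by omega) g hlow
      convert this using 2 with i
      have := hhigh i
      grind

/-- Every block of three vertices following a cleared initial segment can be cleared, disturbing
only the last vertex of the initial segment. -/
theorem exists_lineReach_block (n s : ℕ) (hs : s + 3 ≤ n) (f : ℕ → ZMod 2) :
    ∃ g, LineReach n f g ∧ (∀ i, i + 1 < s → g i = f i) ∧
      g s = 0 ∧ g (s + 1) = 0 ∧ g (s + 2) = 0 := by
  have key (L : List ℕ) (hL : ∀ i ∈ L, s ≤ i ∧ i < n) :
      LineReach n f (L.foldl (fun f i => lineToggle i f) f) ∧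
        ∀ i, i + 1 < s → L.foldl (fun f i => lineToggle i f) f i = f i := by
    induction L generalizing f with
    | nil => exact ⟨.refl, fun _ _ => rfl⟩
    | cons a L ih =>
      have ha := hL a (by simp)
      obtain ⟨h1, h2⟩ := ih (lineToggle a f) (fun i hi => hL i (by simp [hi]))
      refine ⟨.toggle ha.2 h1, fun i hi => (h2 i hi).trans ?_⟩
      simp only [lineToggle]
      grind
  have hz : (1 : ZMod 2) + 1 = 0 := by decide
  suffices h : ∃ L : List ℕ, (∀ i ∈ L, s ≤ i ∧ i < n) ∧
      ∀ j < 3, L.foldl (fun f i => lineToggle i f) f (s + j) = 0 by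
    obtain ⟨L, hL, h⟩ := h
    exact ⟨_, (key L hL).1, (key L hL).2, h 0 (by simp), h 1 (by simp), h 2 (by simp)⟩
  have hmem (L : List ℕ) (hL : ∀ i ∈ L, i < 3) : ∀ i ∈ L.map (s + ·), s ≤ i ∧ i < n := by
    intro i hi
    obtain ⟨j, hj, rfl⟩ := List.mem_map.1 hi
    have := hL j hj
    omega
  suffices h : ∃ L : List ℕ, (∀ i ∈ L, i < 3) ∧
      ∀ j < 3, (L.map (s + ·)).foldl (fun f i => lineToggle i f) f (s + j) = 0 by
    obtain ⟨L, hL, h⟩ := h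
    exact ⟨_, hmem L hL, h⟩
  rcases zmod_two_eq_zero_or_one (f s) with h0 | h0 <;>
  rcases zmod_two_eq_zero_or_one (f (s + 1)) with h1 | h1 <;>
  rcases zmod_two_eq_zero_or_one (f (s + 2)) with h2 | h2
  on_goal 1 => refine ⟨[], by decide, fun j hj => ?_⟩
  on_goal 2 => refine ⟨[2, 1, 0, 2], by decide, fun j hj => ?_⟩
  on_goal 3 => refine ⟨[1, 2, 0], by decide, fun j hj => ?_⟩
  on_goal 4 => refine ⟨[2], by decide, fun j hj => ?_⟩
  on_goal 5 => refine ⟨[0, 1, 2, 0], by decide, fun j hj => ?_⟩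
  on_goal 6 => refine ⟨[2, 0], by decide, fun j hj => ?_⟩
  on_goal 7 => refine ⟨[0], by decide, fun j hj => ?_⟩
  on_goal 8 => refine ⟨[0, 2, 1, 0, 2], by decide, fun j hj => ?_⟩
  all_goals interval_cases j <;> simp [lineToggle, Nat.add_assoc, h0, h1, h2, hz]

theorem exists_lineReach_clear (n q : ℕ) (hq : 3 * q ≤ n) (f : ℕ → ZMod 2) :
    ∃ g, LineReach n f g ∧ ∀ i < 3 * q, g i = 0 := by
  induction q with
  | zero => exact ⟨f, .refl, by simp⟩
  | succ q ih =>
    obtain ⟨g, hfg, hg⟩ := ih (by omega)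
    obtain ⟨g', hgg', hlow, h0, h1, h2⟩ := exists_lineReach_block n (3 * q) (by omega) g
    refine ⟨_, (hfg.trans hgg').trans (exists_lineReach_fix n q (by omega) g' fun i hi => ?_), ?_⟩
    · rw [hlow i hi, hg i (by omega)]
    · intro i hi
      obtain hi | rfl | rfl | rfl :
        i < 3 * q ∨ i = 3 * q ∨ i = 3 * q + 1 ∨ i = 3 * q + 2 := by omega
      all_goals simp [*]

theorem gAW_pathGraph_two {n : ℕ} (hn : n % 3 = 0 ∨ n % 3 = 1) :
    gAW (SimpleGraph.pathGraph n) 2 := by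
  intro lab
  let f : ℕ → ZMod 2 := fun i => if h : i < n then lab ⟨i, h⟩ else 0
  have hf : lab = fun i : Fin n => f i := by
    funext i
    simp [f]
  suffices h : ∃ g, LineReach n f g ∧ ∀ i < n, g i = 0 by
    obtain ⟨g, hfg, hg⟩ := h
    obtain ⟨L, hL⟩ := hfg.exists_gPlay
    refine ⟨L, ?_⟩
    rw [hf, hL]
    exact funext fun i => hg i i.2
  obtain ⟨g, hfg, hg⟩ := exists_lineReach_clear n (n / 3) (by omega) f
  rcases hn with hn | hn
  · exact ⟨g, hfg, fun i hi => hg i (by omega)⟩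
  set s := 3 * (n / 3)
  rcases zmod_two_eq_zero_or_one (g s) with h | h
  · refine ⟨g, hfg, fun i hi => ?_⟩
    obtain hi | rfl : i < s ∨ i = s := by omega
    exacts [hg i hi, h]
  refine ⟨_, hfg.trans (LineReach.toggle (i := s) (by omega)
    (exists_lineReach_fix n (n / 3) (by omega) _ fun i hi => ?_)), fun i hi => ?_⟩
  · have := hg i (by omega)
    simp only [lineToggle]
    grind
  · have hz : (1 : ZMod 2) + 1 = 0 := by decide
    obtain hi | rfl : i < s ∨ i = s := by omega
    · exact if_pos hi
    · simp [s, lineToggle]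
      exact (congrArg₂ (· + ·) h h).trans hz

/-- A mod-`m` weight whose closed neighborhood sums vanish gives an invariant of the game. -/
theorem sum_mul_gPlay {V : Type*} [Fintype V] [DecidableEq V] (G : SimpleGraph V)
    [DecidableRel G.Adj] {m : ℕ} (u : V → ZMod m)
    (hu : ∀ v, (∑ w, if w = v ∨ G.Adj v w then u w else 0) = 0)
    (L : List V) (lab : V → ZMod m) :
    ∑ w, u w * gPlay G L lab w = ∑ w, u w * lab w := by
  induction L generalizing lab with
  | nil => rfl
  | cons v L ih =>
    refine (ih (gToggle G v lab)).trans ?_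
    have h (w : V) : u w * gToggle G v lab w =
        u w * lab w + (if w = v ∨ G.Adj v w then u w else 0) * lab v := by
      simp only [gToggle]
      split_ifs <;> ring
    simp only [h, Finset.sum_add_distrib, ← Finset.sum_mul]
    rw [hu v, zero_mul, add_zero]

/-- The kernel vector `1, 1, 0, 1, 1, 0, …` of the closed neighborhood matrix. -/
theorem sum_closedNeighborhood_pathGraph {n : ℕ} [DecidableRel (SimpleGraph.pathGraph n).Adj]
    (hn : n % 3 = 2) (v : Fin n) :
    (∑ w : Fin n, if w = v ∨ (SimpleGraph.pathGraph n).Adj v w then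
      (if (w : ℕ) % 3 = 2 then 0 else 1 : ZMod 2) else 0) = 0 := by
  have hz : (1 : ZMod 2) + 1 = 0 := by decide
  set c : ℕ → ZMod 2 := fun j => if j % 3 = 2 then 0 else 1 with hc
  have h1 : ∀ w : Fin n, (if w = v ∨ (SimpleGraph.pathGraph n).Adj v w then
      (if (w : ℕ) % 3 = 2 then 0 else 1 : ZMod 2) else 0) =
      (if (w : ℕ) = v then c v else 0) + (if (w : ℕ) = v + 1 then c (v + 1) else 0) +
        (if (w : ℕ) + 1 = v then c (v + 2) else 0) := by
    intro w
    simp only [SimpleGraph.pathGraph_adj, Fin.ext_iff, hc]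
    grind
  have hv := v.2
  rw [Finset.sum_congr rfl fun w _ => h1 w,
    Fin.sum_univ_eq_sum_range (fun w => (if w = (v : ℕ) then c v else 0) +
      (if w = (v : ℕ) + 1 then c (v + 1) else 0) + (if w + 1 = (v : ℕ) then c (v + 2) else 0)) n,
    Finset.sum_add_distrib, Finset.sum_add_distrib]
  have h2 : ∑ w ∈ Finset.range n, (if w + 1 = (v : ℕ) then c (v + 2) else 0) =
      if 0 < (v : ℕ) then c (v + 2) else 0 := by
    rcases hv0 : (v : ℕ) with _ | t
    · simp
    · simp; omega
  rw [h2]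
  simp only [Finset.sum_ite_eq', Finset.mem_range, hc]
  grind

theorem not_gAW_pathGraph {n m : ℕ} (hm : 2 ∣ m) (hn : n % 3 = 2) :
    ¬ gAW (SimpleGraph.pathGraph n) m := by
  classical
  intro h
  let v₀ : Fin n := ⟨0, by omega⟩
  let φ := (ZMod.castHom hm (ZMod 2)).toAddMonoidHom
  obtain ⟨L, hL⟩ := h (Pi.single v₀ 1)
  have h1 := gPlay_map (SimpleGraph.pathGraph n) φ L (Pi.single v₀ 1)
  have h2 := sum_mul_gPlay (SimpleGraph.pathGraph n) _ (sum_closedNeighborhood_pathGraph hn) L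
    (φ ∘ Pi.single v₀ 1)
  rw [h1, hL] at h2
  have h3 : (φ ∘ Pi.single v₀ 1 : Fin n → ZMod 2) = Pi.single v₀ 1 := by
    funext i
    by_cases hi : i = v₀
    · subst hi
      simpa [φ] using ZMod.cast_one hm
    · simp [hi]
  rw [h3] at h2
  simp [Pi.single_apply, v₀] at h2

theorem stmt17 (n k : ℕ) (hn : 1 ≤ n) (hk : 1 ≤ k) :
    gAW (SimpleGraph.pathGraph n) (2 ^ k) ↔ (n % 3 = 0 ∨ n % 3 = 1) := by
  refine ⟨fun h => ?_, fun h => (gAW_pathGraph_two h).pow k⟩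
  by_contra hcon
  exact not_gAW_pathGraph (dvd_pow_self 2 (by omega)) (by omega) h
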